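/- Let S be a countable nonempty state space, A an action space, π : S → A a deterministic policy, P, P̂ : S → A → PMF(S) two transition kernels, r, r̂ : S × A → ℝ two bounded reward functions with |r(s,a)| ≤ R_max for all (s,a), γ ∈ [0,1), and ρ ∈ [0,1]. Set α_r := sup_{(s,a)} |r(s,a) − r̂(s,a)| and α_P := sup_{(s,a)} Σ_{s'} |P(s,a)(s') − P̂(s,a)(s')|, and define the mixtures r_ρ := (1−ρ)r + ρr̂ and P_ρ(s,a) := (1−ρ)·P(s,a) + ρ·P̂(s,a). Let V_∞^{r,P}(s) := Σ_{i=0}^∞ γ^i · E_{s_i}[ r(s_i, π(s_i)) ] denote the infinite-horizon discounted value under kernel P and policy π (where the state distribution at step i is obtained by i-fold monadic binding of the kernel starting from s), and let V_H^{r_ρ,P_ρ} denote the H-step value under (r_ρ, P_ρ, π) with zero terminal value. Then for every H ≥ 1 and every state s, |V_∞^{r,P}(s) − V_H^{r_ρ,P_ρ}(s)| ≤ ρ·α_P·H·γ·((1−γ^{H−1})/(1−γ))·(span(r)/2) + ρ·α_r·((1−γ^H)/(1−γ)) + R_max·γ^H/(1−γ), where span(r) := sup r − inf r. -/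

import Mathlib

open scoped ENNReal

/-- Convex mixture `(1-ρ)·p + ρ·q` of two probability mass functions. -/
noncomputable def mixPMF {S : Type*} (ρ : ℝ) (hρ0 : 0 ≤ ρ) (hρ1 : ρ ≤ 1) (p q : PMF S) :
    PMF S :=
  ⟨fun s => ENNReal.ofReal (1 - ρ) * p s + ENNReal.ofReal ρ * q s, by
    have h : ∑' s, (ENNReal.ofReal (1 - ρ) * p s + ENNReal.ofReal ρ * q s) = 1 := by
      rw [ENNReal.tsum_add, ENNReal.tsum_mul_left, ENNReal.tsum_mul_left, p.tsum_coe,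
        q.tsum_coe, mul_one, mul_one, ← ENNReal.ofReal_add (by linarith) hρ0]
      norm_num
    exact h ▸ ENNReal.summable.hasSum⟩

/-- `H`-step value function with zero terminal value. -/
noncomputable def stepValue {S A : Type*} (π : S → A) (Q : S → A → PMF S)
    (c : S × A → ℝ) (γ : ℝ) : ℕ → S → ℝ
  | 0, _ => 0
  | k + 1, s => c (s, π s) + γ * ∑' s', (Q s (π s) s').toReal * stepValue π Q c γ k s'

/-- Distribution of the state after `i` steps, starting from `s`, following policy `π` in
kernel `P` (`i`-fold monadic bind of the kernel). -/
noncomputable def stateDist {S A : Type*} (π : S → A) (P : S → A → PMF S) (s : S) :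
    ℕ → PMF S
  | 0 => PMF.pure s
  | i + 1 => (stateDist π P s i).bind fun s' => P s' (π s')

/-- Infinite-horizon discounted value `V_∞(s) = ∑_i γ^i E_{s_i}[r (s_i, π s_i)]`. -/
noncomputable def infValue {S A : Type*} (π : S → A) (P : S → A → PMF S)
    (r : S × A → ℝ) (γ : ℝ) (s : S) : ℝ :=
  ∑' i : ℕ, γ ^ i * ∑' s' : S, ((stateDist π P s i) s').toReal * r (s', π s')

/-- Expectation of a real function under a probability mass function, as a series. -/
noncomputable def PMF.expect {S : Type*} (p : PMF S) (f : S → ℝ) : ℝ :=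
  ∑' s, (p s).toReal * f s

namespace PMF

variable {S : Type*}

theorem summable_toReal (p : PMF S) : Summable fun s => (p s).toReal :=
  ENNReal.summable_toReal p.tsum_coe_ne_top

theorem tsum_toReal (p : PMF S) : ∑' s, (p s).toReal = 1 := by
  rw [← ENNReal.tsum_toReal_eq p.apply_ne_top, p.tsum_coe, ENNReal.toReal_one]

theorem summable_toReal_mul (p : PMF S) {f : S → ℝ} {B : ℝ} (hf : ∀ s, |f s| ≤ B) :
    Summable fun s => (p s).toReal * f s := by
  refine Summable.of_norm_bounded (p.summable_toReal.mul_right B) fun s => ?_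
  rw [Real.norm_eq_abs, abs_mul, abs_of_nonneg ENNReal.toReal_nonneg]
  exact mul_le_mul_of_nonneg_left (hf s) ENNReal.toReal_nonneg

theorem expect_const (p : PMF S) (c : ℝ) : p.expect (fun _ => c) = c := by
  rw [expect, tsum_mul_right, p.tsum_toReal, one_mul]

theorem expect_mono (p : PMF S) {f g : S → ℝ} {B C : ℝ} (hf : ∀ s, |f s| ≤ B)
    (hg : ∀ s, |g s| ≤ C) (h : ∀ s, f s ≤ g s) : p.expect f ≤ p.expect g :=
  (p.summable_toReal_mul hf).tsum_le_tsum
    (fun s => mul_le_mul_of_nonneg_left (h s) ENNReal.toReal_nonneg) (p.summable_toReal_mul hg)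

theorem expect_mem_Icc (p : PMF S) {f : S → ℝ} {m M : ℝ} (h : ∀ s, f s ∈ Set.Icc m M) :
    p.expect f ∈ Set.Icc m M := by
  have hf : ∀ s, |f s| ≤ max |m| |M| := fun s => abs_le_max_abs_abs (h s).1 (h s).2
  constructor
  · simpa [expect_const] using
      p.expect_mono (f := fun _ => m) (fun _ => le_rfl) hf fun s => (h s).1
  · simpa [expect_const] using
      p.expect_mono (g := fun _ => M) hf (fun _ => le_rfl) fun s => (h s).2

theorem abs_expect_le (p : PMF S) {f : S → ℝ} {B : ℝ} (hf : ∀ s, |f s| ≤ B) :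
    |p.expect f| ≤ B :=
  abs_le.2 (p.expect_mem_Icc fun s => abs_le.1 (hf s))

theorem expect_sub (p : PMF S) {f g : S → ℝ} {B C : ℝ} (hf : ∀ s, |f s| ≤ B)
    (hg : ∀ s, |g s| ≤ C) : p.expect (fun s => f s - g s) = p.expect f - p.expect g := by
  simp only [expect, mul_sub]
  exact (p.summable_toReal_mul hf).tsum_sub (p.summable_toReal_mul hg)

theorem expect_const_mul (p : PMF S) (c : ℝ) (f : S → ℝ) :
    p.expect (fun s => c * f s) = c * p.expect f := by
  simp only [expect, mul_left_comm _ c, tsum_mul_left]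

theorem expect_sum (p : PMF S) {ι : Type*} (t : Finset ι) {f : ι → S → ℝ} {B : ι → ℝ}
    (hf : ∀ i s, |f i s| ≤ B i) :
    p.expect (fun s => ∑ i ∈ t, f i s) = ∑ i ∈ t, p.expect (f i) := by
  simp only [expect, Finset.mul_sum]
  exact Summable.tsum_finsetSum fun i _ => p.summable_toReal_mul (hf i)

theorem toReal_bind_apply {T : Type*} (p : PMF S) (k : S → PMF T) (t : T) :
    ((p.bind k) t).toReal = ∑' s, (p s).toReal * (k s t).toReal := by
  rw [PMF.bind_apply, ENNReal.tsum_toReal_eq fun s =>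
    ENNReal.mul_ne_top (p.apply_ne_top s) ((k s).apply_ne_top t)]
  simp only [ENNReal.toReal_mul]

theorem expect_bind {T : Type*} (p : PMF S) (k : S → PMF T) {f : T → ℝ} {B : ℝ}
    (hf : ∀ t, |f t| ≤ B) : (p.bind k).expect f = p.expect fun s => (k s).expect f := by
  have h0 : ∀ x : S × T, 0 ≤ (p x.1).toReal * (k x.1 x.2).toReal := fun _ =>
    mul_nonneg ENNReal.toReal_nonneg ENNReal.toReal_nonneg
  have hk : Summable fun x : S × T => (p x.1).toReal * (k x.1 x.2).toReal := by
    rw [summable_prod_of_nonneg h0]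
    refine ⟨fun s => Summable.mul_left (p s).toReal (k s).summable_toReal, ?_⟩
    simpa only [tsum_mul_left, tsum_toReal, mul_one] using p.summable_toReal
  have hs : Summable fun x : S × T => (p x.1).toReal * (k x.1 x.2).toReal * f x.2 := by
    refine Summable.of_norm_bounded (hk.mul_right B) fun x => ?_
    rw [norm_mul, Real.norm_of_nonneg (h0 x)]
    exact mul_le_mul_of_nonneg_left (hf x.2) (h0 x)
  simp only [expect, toReal_bind_apply, ← tsum_mul_left, ← tsum_mul_right, ← mul_assoc]
  exact hs.tsum_comm

/-- Expectations of a function with values in `[m, M]` under two mass functions differ by at most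
their `ℓ¹` distance times half the range. -/
theorem abs_expect_sub_expect_le (p q : PMF S) {f : S → ℝ} {m M : ℝ}
    (h : ∀ s, f s ∈ Set.Icc m M) :
    |p.expect f - q.expect f| ≤ (∑' s, |(p s).toReal - (q s).toReal|) * ((M - m) / 2) := by
  have hf : ∀ s, |f s| ≤ max |m| |M| := fun s => abs_le_max_abs_abs (h s).1 (h s).2
  have hd : Summable fun s => |(p s).toReal - (q s).toReal| :=
    (p.summable_toReal.sub q.summable_toReal).abs
  have hcenter : p.expect f - q.expect f =
      ∑' s, ((p s).toReal - (q s).toReal) * (f s - (m + M) / 2) := by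
    have hc : ∑' s, ((p s).toReal - (q s).toReal) * ((m + M) / 2) = 0 := by
      rw [tsum_mul_right, p.summable_toReal.tsum_sub q.summable_toReal, p.tsum_toReal,
        q.tsum_toReal, sub_self, zero_mul]
    have hfs : Summable fun s => ((p s).toReal - (q s).toReal) * f s := by
      simpa only [sub_mul] using (p.summable_toReal_mul hf).sub (q.summable_toReal_mul hf)
    simp only [mul_sub]
    rw [hfs.tsum_sub ((p.summable_toReal.sub q.summable_toReal).mul_right _), hc, sub_zero]
    simp only [sub_mul]
    exact ((p.summable_toReal_mul hf).tsum_sub (q.summable_toReal_mul hf)).symm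
  rw [hcenter, ← tsum_mul_right, ← Real.norm_eq_abs]
  refine tsum_of_norm_bounded (hd.mul_right _).hasSum fun s => ?_
  rw [norm_mul]
  refine mul_le_mul_of_nonneg_left ?_ (abs_nonneg _)
  rw [Real.norm_eq_abs, abs_le]
  constructor <;> linarith [(h s).1, (h s).2]

theorem tsum_abs_toReal_sub_le_two (p q : PMF S) :
    ∑' s, |(p s).toReal - (q s).toReal| ≤ 2 := by
  calc ∑' s, |(p s).toReal - (q s).toReal| ≤ ∑' s, ((p s).toReal + (q s).toReal) :=
        (p.summable_toReal.sub q.summable_toReal).abs.tsum_le_tsum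
          (fun s => (abs_sub _ _).trans_eq (by simp)) (p.summable_toReal.add q.summable_toReal)
    _ = 2 := by
        rw [p.summable_toReal.tsum_add q.summable_toReal, p.tsum_toReal, q.tsum_toReal]
        norm_num

theorem expect_mixPMF (p q : PMF S) {ρ : ℝ} (hρ0 : 0 ≤ ρ) (hρ1 : ρ ≤ 1) {f : S → ℝ} {B : ℝ}
    (hf : ∀ s, |f s| ≤ B) :
    (mixPMF ρ hρ0 hρ1 p q).expect f = (1 - ρ) * p.expect f + ρ * q.expect f := by
  have happ : ∀ s, (mixPMF ρ hρ0 hρ1 p q s).toReal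
      = (1 - ρ) * (p s).toReal + ρ * (q s).toReal := fun s => by
    change (ENNReal.ofReal (1 - ρ) * p s + ENNReal.ofReal ρ * q s).toReal = _
    rw [ENNReal.toReal_add (ENNReal.mul_ne_top ENNReal.ofReal_ne_top (p.apply_ne_top s))
      (ENNReal.mul_ne_top ENNReal.ofReal_ne_top (q.apply_ne_top s)), ENNReal.toReal_mul,
      ENNReal.toReal_mul, ENNReal.toReal_ofReal (by linarith), ENNReal.toReal_ofReal hρ0]
  simp only [expect, happ, add_mul, mul_assoc]
  rw [((p.summable_toReal_mul hf).mul_left _).tsum_add ((q.summable_toReal_mul hf).mul_left _),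
    tsum_mul_left, tsum_mul_left]

end PMF

section Value

variable {S A : Type*} (π : S → A) (Q : S → A → PMF S)

theorem stepValue_succ (c : S × A → ℝ) (γ : ℝ) (k : ℕ) (s : S) :
    stepValue π Q c γ (k + 1) s =
      c (s, π s) + γ * (Q s (π s)).expect (stepValue π Q c γ k) := rfl

theorem stepValue_mem_Icc {c : S × A → ℝ} {m M γ : ℝ} (hγ : 0 ≤ γ)
    (hc : ∀ x, c x ∈ Set.Icc m M) (k : ℕ) (s : S) :
    stepValue π Q c γ k s ∈
      Set.Icc (m * ∑ i ∈ Finset.range k, γ ^ i) (M * ∑ i ∈ Finset.range k, γ ^ i) := by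
  induction k generalizing s with
  | zero => simp [stepValue]
  | succ k ih =>
    have h := (Q s (π s)).expect_mem_Icc ih
    rw [stepValue_succ, geom_sum_succ]
    constructor
    · linarith [mul_le_mul_of_nonneg_left h.1 hγ, (hc (s, π s)).1]
    · linarith [mul_le_mul_of_nonneg_left h.2 hγ, (hc (s, π s)).2]

theorem abs_stepValue_le {c : S × A → ℝ} {B γ : ℝ} (hγ : 0 ≤ γ) (hc : ∀ x, |c x| ≤ B)
    (k : ℕ) (s : S) : |stepValue π Q c γ k s| ≤ B * ∑ i ∈ Finset.range k, γ ^ i := by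
  rw [abs_le, ← neg_mul]
  exact stepValue_mem_Icc π Q hγ (fun x => abs_le.1 (hc x)) k s

theorem stateDist_succ_left (s : S) (i : ℕ) :
    stateDist π Q s (i + 1) = (Q s (π s)).bind fun s' => stateDist π Q s' i := by
  induction i with
  | zero => simp [stateDist]
  | succ i ih =>
    rw [stateDist, ih, PMF.bind_bind]
    rfl

theorem stepValue_eq_sum {c : S × A → ℝ} {B : ℝ} (hc : ∀ x, |c x| ≤ B) (γ : ℝ) (k : ℕ) (s : S) :
    stepValue π Q c γ k s =
      ∑ i ∈ Finset.range k, γ ^ i * (stateDist π Q s i).expect fun s' => c (s', π s') := by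
  induction k generalizing s with
  | zero => simp [stepValue]
  | succ k ih =>
    rw [stepValue_succ, funext ih, PMF.expect_sum _ _
      (f := fun i t => γ ^ i * (stateDist π Q t i).expect fun s' => c (s', π s'))
      (B := fun i => |γ ^ i| * B), Finset.mul_sum, Finset.sum_range_succ']
    · simp only [PMF.expect_const_mul, stateDist_succ_left,
        PMF.expect_bind _ _ fun s' => hc (s', π s')]
      rw [add_comm]
      congr 1
      · exact Finset.sum_congr rfl fun i _ => by ring
      · simp [stateDist, PMF.expect, PMF.pure_apply, apply_ite ENNReal.toReal, ite_mul]
    · intro i s'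
      rw [abs_mul]
      exact mul_le_mul_of_nonneg_left (PMF.abs_expect_le _ fun t => hc (t, π t)) (abs_nonneg _)

theorem abs_infValue_sub_stepValue_le {c : S × A → ℝ} {B γ : ℝ} (hγ0 : 0 ≤ γ) (hγ1 : γ < 1)
    (hc : ∀ x, |c x| ≤ B) (k : ℕ) (s : S) :
    |infValue π Q c γ s - stepValue π Q c γ k s| ≤ B * γ ^ k / (1 - γ) := by
  set u : ℕ → ℝ := fun i => γ ^ i * (stateDist π Q s i).expect fun s' => c (s', π s') with hu
  have hbound : ∀ i, ‖u i‖ ≤ γ ^ i * B := fun i => by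
    rw [Real.norm_eq_abs, hu, abs_mul, abs_of_nonneg (pow_nonneg hγ0 i)]
    exact mul_le_mul_of_nonneg_left (PMF.abs_expect_le _ fun t => hc (t, π t)) (pow_nonneg hγ0 i)
  have hsum : Summable u :=
    Summable.of_norm_bounded ((summable_geometric_of_lt_one hγ0 hγ1).mul_right B) hbound
  have htail : infValue π Q c γ s - stepValue π Q c γ k s = ∑' i, u (i + k) := by
    rw [stepValue_eq_sum π Q hc, sub_eq_iff_eq_add']
    exact (hsum.sum_add_tsum_nat_add k).symm
  rw [htail, ← Real.norm_eq_abs]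
  refine tsum_of_norm_bounded (g := fun i => γ ^ i * (B * γ ^ k)) ?_ fun i => ?_
  · rw [div_eq_inv_mul]
    exact (hasSum_geometric_of_lt_one hγ0 hγ1).mul_right _
  · exact (hbound (i + k)).trans_eq (by ring)

theorem abs_stepValue_sub_stepValue_mix_le (Q' : S → A → PMF S) {c c' : S × A → ℝ}
    {m M B' γ ρ δ ε : ℝ} (hγ : 0 ≤ γ) (hρ0 : 0 ≤ ρ) (hρ1 : ρ ≤ 1)
    (hc : ∀ x, c x ∈ Set.Icc m M) (hc' : ∀ x, |c' x| ≤ B')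
    (hδ : ∀ x, |c x - c' x| ≤ δ)
    (hε : ∀ s a, ∑' t, |(Q s a t).toReal - (Q' s a t).toReal| ≤ ε) (k : ℕ) (s : S) :
    |stepValue π Q c γ k s - stepValue π (fun s a => mixPMF ρ hρ0 hρ1 (Q s a) (Q' s a))
        (fun x => (1 - ρ) * c x + ρ * c' x) γ k s| ≤
      ρ * ε * k * γ * (∑ i ∈ Finset.range (k - 1), γ ^ i) * ((M - m) / 2) +
        ρ * δ * ∑ i ∈ Finset.range k, γ ^ i := by
  induction k generalizing s with
  | zero => simp [stepValue]
  | succ k ih =>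
    set V := stepValue π Q c γ k
    set R := fun s a => mixPMF ρ hρ0 hρ1 (Q s a) (Q' s a)
    set d := fun x => (1 - ρ) * c x + ρ * c' x with hd
    set W := stepValue π R d γ k
    have hV : ∀ t, V t ∈ _ := stepValue_mem_Icc π Q hγ hc k
    have hVb : ∀ t, |V t| ≤ _ := fun t => abs_le_max_abs_abs (hV t).1 (hV t).2
    have hdb : ∀ x, |d x| ≤ max |m| |M| + B' := fun x => by
      have hcx := abs_le_max_abs_abs (hc x).1 (hc x).2
      have hcx' := hc' x
      calc |d x| ≤ (1 - ρ) * |c x| + ρ * |c' x| := by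
            refine (abs_add_le _ _).trans_eq ?_
            rw [abs_mul, abs_mul, abs_of_nonneg hρ0, abs_of_nonneg (sub_nonneg.2 hρ1)]
        _ ≤ _ := by nlinarith [abs_nonneg (c x), abs_nonneg (c' x)]
    have hWb : ∀ t, |W t| ≤ _ := abs_stepValue_le π R hγ hdb k
    have hdiff : stepValue π Q c γ (k + 1) s - stepValue π R d γ (k + 1) s =
        ρ * (c (s, π s) - c' (s, π s)) +
          γ * (ρ * ((Q s (π s)).expect V - (Q' s (π s)).expect V)) +
          γ * (R s (π s)).expect fun t => V t - W t := by
      rw [stepValue_succ, stepValue_succ, PMF.expect_sub _ hVb hWb,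
        PMF.expect_mixPMF _ _ hρ0 hρ1 hVb]
      ring
    have hreward := mul_le_mul_of_nonneg_left (hδ (s, π s)) hρ0
    have hmM : 0 ≤ M - m := sub_nonneg.2 ((hc (s, π s)).1.trans (hc (s, π s)).2)
    have hG : ∀ n, 0 ≤ ∑ i ∈ Finset.range n, γ ^ i := fun n =>
      Finset.sum_nonneg fun i _ => pow_nonneg hγ i
    have hε0 : 0 ≤ ε := (tsum_nonneg fun _ => abs_nonneg _).trans (hε s (π s))
    have hkernel : |(Q s (π s)).expect V - (Q' s (π s)).expect V| ≤
        ε * ((∑ i ∈ Finset.range k, γ ^ i) * ((M - m) / 2)) := by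
      refine (PMF.abs_expect_sub_expect_le _ _ hV).trans ?_
      rw [← sub_mul, mul_comm (M - m), mul_div_assoc]
      exact mul_le_mul_of_nonneg_right (hε s (π s)) (mul_nonneg (hG k) (by linarith))
    have hprev := (R s (π s)).abs_expect_le ih
    have hgeom : (k : ℝ) * (γ * ∑ i ∈ Finset.range (k - 1), γ ^ i) ≤
        k * ∑ i ∈ Finset.range k, γ ^ i := by
      cases k with
      | zero => simp
      | succ k =>
        rw [geom_sum_succ (n := k), Nat.add_sub_cancel]
        exact mul_le_mul_of_nonneg_left (by linarith) (Nat.cast_nonneg _)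
    rw [hdiff]
    refine (abs_add_three _ _ _).trans ?_
    rw [abs_mul, abs_mul γ, abs_mul ρ, abs_mul γ, abs_of_nonneg hρ0, abs_of_nonneg hγ,
      geom_sum_succ (n := k), Nat.add_sub_cancel, Nat.cast_succ]
    have hcoef : 0 ≤ γ * (ρ * ε * ((M - m) / 2)) := by positivity
    have := mul_le_mul_of_nonneg_left (mul_le_mul_of_nonneg_left hkernel hρ0) hγ
    have := mul_le_mul_of_nonneg_left hprev hγ
    have := mul_le_mul_of_nonneg_left hgeom hcoef
    linarith

end Value

/-- **Value-function error bound (model mismatch + horizon truncation).**  The infinite-horizon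
value under the true MDP `(r, P)` differs from the `H`-step value (zero terminal) under the
`ρ`-mixed model `(r_ρ, P_ρ)` by at most
`ρ·α_P·H·γ·((1-γ^(H-1))/(1-γ))·span(r)/2 + ρ·α_r·((1-γ^H)/(1-γ)) + R_max·γ^H/(1-γ)`. -/
theorem value_error_model_mismatch_and_truncation
    {S A : Type*} [Countable S] [Nonempty S]
    (π : S → A) (P Phat : S → A → PMF S) (r rhat : S × A → ℝ)
    (Rmax : ℝ) (hRmax : ∀ p, |r p| ≤ Rmax) (hrhat : ∃ B, ∀ p, |rhat p| ≤ B)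
    (γ : ℝ) (hγ0 : 0 ≤ γ) (hγ1 : γ < 1)
    (ρ : ℝ) (hρ0 : 0 ≤ ρ) (hρ1 : ρ ≤ 1)
    (αr αP : ℝ)
    (hαr : αr = ⨆ p : S × A, |r p - rhat p|)
    (hαP : αP = ⨆ p : S × A, ∑' s' : S, |(P p.1 p.2 s').toReal - (Phat p.1 p.2 s').toReal|)
    (H : ℕ) (hH : 1 ≤ H) (s : S) :
    |infValue π P r γ s -
        stepValue π (fun s a => mixPMF ρ hρ0 hρ1 (P s a) (Phat s a))
          (fun p => (1 - ρ) * r p + ρ * rhat p) γ H s| ≤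
      ρ * αP * H * γ * ((1 - γ ^ (H - 1)) / (1 - γ)) *
          (((⨆ p : S × A, r p) - ⨅ p : S × A, r p) / 2) +
        ρ * αr * ((1 - γ ^ H) / (1 - γ)) + Rmax * γ ^ H / (1 - γ) := by
  obtain ⟨B, hB⟩ := hrhat
  have hsup : BddAbove (Set.range r) :=
    ⟨Rmax, Set.forall_mem_range.2 fun p => (abs_le.1 (hRmax p)).2⟩
  have hinf : BddBelow (Set.range r) :=
    ⟨-Rmax, Set.forall_mem_range.2 fun p => (abs_le.1 (hRmax p)).1⟩
  have hδ : ∀ p, |r p - rhat p| ≤ αr := fun p => by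
    rw [hαr]
    exact le_ciSup (f := fun p => |r p - rhat p|) ⟨Rmax + B, Set.forall_mem_range.2 fun p =>
      (abs_sub _ _).trans (add_le_add (hRmax p) (hB p))⟩ p
  have hε : ∀ s a, ∑' t, |(P s a t).toReal - (Phat s a t).toReal| ≤ αP := fun s a => by
    rw [hαP]
    exact le_ciSup
      (f := fun p : S × A => ∑' t, |(P p.1 p.2 t).toReal - (Phat p.1 p.2 t).toReal|)
      ⟨2, Set.forall_mem_range.2 fun p => PMF.tsum_abs_toReal_sub_le_two _ _⟩ (s, a)
  have hmodel := abs_stepValue_sub_stepValue_mix_le π P Phat hγ0 hρ0 hρ1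
    (fun x => ⟨ciInf_le hinf x, le_ciSup hsup x⟩) hB hδ hε H s
  have hgeom : ∀ n, ∑ i ∈ Finset.range n, γ ^ i = (1 - γ ^ n) / (1 - γ) := fun n => by
    rw [geom_sum_eq hγ1.ne, ← neg_div_neg_eq, neg_sub, neg_sub]
  rw [hgeom, hgeom] at hmodel
  refine (abs_sub_le _ (stepValue π P r γ H s) _).trans ?_
  linarith [abs_infValue_sub_stepValue_le π P hγ0 hγ1 hRmax H s]
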